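/- arXiv:1406.4895 — 3 statements merged into one kernel-verified Lean document; each statement's English description precedes it below -/
import Mathlib

section
/- Let P_1, …, P_k ⊆ ℝ^p be nonempty polytopes. Then xc(conv(P_1 ∪ ⋯ ∪ P_k)) ≤ Σ_{i=1}^k xc(P_i) + |{i ∈ {1,…,k} : P_i is a singleton}|. -/
/-- `P` admits an extended formulation with `m` inequalities (and finitely many
linear equations): a feasible region in some `ℝ^q` projecting linearly onto `P`. -/
def IsExtFormulation {p : ℕ} (P : Set (Fin p → ℝ)) (m : ℕ) : Prop :=
  ∃ (q s : ℕ) (A : Matrix (Fin m) (Fin q) ℝ) (b : Fin m → ℝ)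
    (C : Matrix (Fin s) (Fin q) ℝ) (d : Fin s → ℝ)
    (π : (Fin q → ℝ) →ₗ[ℝ] (Fin p → ℝ)),
    π '' {y | A.mulVec y ≤ b ∧ C.mulVec y = d} = P

/-- The extension complexity of `P`: the smallest number of inequalities in any
extended formulation for `P`. -/
noncomputable def xc {p : ℕ} (P : Set (Fin p → ℝ)) : ℕ :=
  sInf {m | IsExtFormulation P m}

/-- A polytope is the convex hull of a finite set of points. -/
def IsPolytope {p : ℕ} (P : Set (Fin p → ℝ)) : Prop :=
  ∃ V : Finset (Fin p → ℝ), P = convexHull ℝ (V : Set (Fin p → ℝ))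

/-- The data of an extended formulation may be given by linear maps on any finite-dimensional
space, with inequalities and equations indexed by arbitrary finite types. -/
theorem isExtFormulation_of_linearMap {p : ℕ} {E ι σ : Type*} [AddCommGroup E] [Module ℝ E]
    [Module.Finite ℝ E] [Finite ι] [Finite σ] (F : E →ₗ[ℝ] ι → ℝ) (b : ι → ℝ)
    (G : E →ₗ[ℝ] σ → ℝ) (d : σ → ℝ) (π : E →ₗ[ℝ] Fin p → ℝ) :
    IsExtFormulation (π '' {y | F y ≤ b ∧ G y = d}) (Nat.card ι) := by
  let e : E ≃ₗ[ℝ] (Fin (Module.finrank ℝ E) → ℝ) := (Module.finBasis ℝ E).equivFun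
  let eι := Finite.equivFin ι
  let eσ := Finite.equivFin σ
  refine ⟨Module.finrank ℝ E, Nat.card σ,
    LinearMap.toMatrix' (LinearMap.funLeft ℝ ℝ eι.symm ∘ₗ F ∘ₗ e.symm.toLinearMap), b ∘ eι.symm,
    LinearMap.toMatrix' (LinearMap.funLeft ℝ ℝ eσ.symm ∘ₗ G ∘ₗ e.symm.toLinearMap), d ∘ eσ.symm,
    π ∘ₗ e.symm.toLinearMap, ?_⟩
  have hF : ∀ y : E, F y ∘ eι.symm ≤ b ∘ eι.symm ↔ F y ≤ b := fun y =>
    ⟨fun h i => by simpa using h (eι i), fun h i => h (eι.symm i)⟩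
  have hG : ∀ y : E, G y ∘ eσ.symm = d ∘ eσ.symm ↔ G y = d := fun _ =>
    eσ.symm.surjective.right_cancellable
  ext x
  simp only [LinearMap.toMatrix'_mulVec, Set.mem_image, Set.mem_ofPred_eq, LinearMap.comp_apply,
    LinearEquiv.coe_coe]
  constructor
  · rintro ⟨y, ⟨h1, h2⟩, rfl⟩
    exact ⟨e.symm y, ⟨(hF _).1 h1, (hG _).1 h2⟩, rfl⟩
  · rintro ⟨y, ⟨h1, h2⟩, rfl⟩
    refine ⟨e y, ?_, by simp⟩
    rw [e.symm_apply_apply]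
    exact ⟨(hF y).2 h1, (hG y).2 h2⟩

/-- Every polytope has an extended formulation, with one inequality for each spanning point. -/
theorem IsPolytope.exists_isExtFormulation {p : ℕ} {P : Set (Fin p → ℝ)} (hP : IsPolytope P) :
    ∃ m, IsExtFormulation P m := by
  obtain ⟨V, rfl⟩ := hP
  have hV := V.finite_toSet
  generalize (V : Set (Fin p → ℝ)) = S at hV
  let := hV.fintype
  let F : (S → ℝ) →ₗ[ℝ] (S → ℝ) := -LinearMap.id
  let G : (S → ℝ) →ₗ[ℝ] (Unit → ℝ) := LinearMap.pi fun _ => ∑ v, LinearMap.proj v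
  have h := isExtFormulation_of_linearMap F 0 G 1
    (∑ v : S, (LinearMap.proj (R := ℝ) (φ := fun _ => ℝ) v).smulRight (v : Fin p → ℝ))
  refine ⟨Nat.card S, ?_⟩
  rw [hV.convexHull_eq_image]
  convert h using 2
  ext w
  simp [F, G, stdSimplex, funext_iff, Pi.le_def]

theorem IsPolytope.isExtFormulation_xc {p : ℕ} {P : Set (Fin p → ℝ)} (hP : IsPolytope P) :
    IsExtFormulation P (xc P) :=
  Nat.sInf_mem hP.exists_isExtFormulation

theorem IsPolytope.isBounded {p : ℕ} {P : Set (Fin p → ℝ)} (hP : IsPolytope P) :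
    Bornology.IsBounded P := by
  obtain ⟨V, rfl⟩ := hP
  exact isBounded_convexHull.2 V.finite_toSet.isBounded

/-- A bounded set contains no ray with nonzero direction. -/
theorem Bornology.IsBounded.eq_zero_of_ray_subset {E : Type*} [NormedAddCommGroup E]
    [NormedSpace ℝ E] {s : Set E} (hs : Bornology.IsBounded s) {x v : E}
    (h : ∀ t : ℝ, 0 ≤ t → x + t • v ∈ s) : v = 0 := by
  obtain ⟨R, hR⟩ := hs.exists_norm_le
  by_contra hv
  have hv' : 0 < ‖v‖ := norm_pos_iff.2 hv
  have hx : ‖x‖ ≤ R := hR x (by simpa using h 0 le_rfl)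
  have hR0 : 0 ≤ R := (norm_nonneg x).trans hx
  have ht : 0 ≤ (2 * R + 1) / ‖v‖ := by positivity
  have h1 := hR _ (h _ ht)
  have h2 : ‖((2 * R + 1) / ‖v‖) • v‖ = 2 * R + 1 := by
    rw [norm_smul, Real.norm_of_nonneg ht, div_mul_cancel₀ _ hv'.ne']
  have h3 := norm_sub_le (x + ((2 * R + 1) / ‖v‖) • v) x
  rw [add_sub_cancel_left, h2] at h3
  linarith

section Homogenization

variable {E ι σ W : Type*} [AddCommGroup E] [Module ℝ E] [NormedAddCommGroup W] [NormedSpace ℝ W]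
  {F : E →ₗ[ℝ] ι → ℝ} {b : ι → ℝ} {G : E →ₗ[ℝ] σ → ℝ} {d : σ → ℝ} {π : E →ₗ[ℝ] W}

/-- Recession directions of a polyhedron with bounded projection project to zero. -/
theorem map_eq_zero_of_recession (hb : Bornology.IsBounded (π '' {y | F y ≤ b ∧ G y = d}))
    {y r : E} (hy : F y ≤ b ∧ G y = d) (hF : F r ≤ 0) (hG : G r = 0) : π r = 0 := by
  refine hb.eq_zero_of_ray_subset (x := π y) fun t ht => ⟨y + t • r, ⟨?_, ?_⟩, by simp⟩
  · intro i
    have h1 := hy.1 i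
    have h2 := mul_nonpos_of_nonneg_of_nonpos ht (hF i)
    simp only [map_add, map_smul, Pi.add_apply, Pi.smul_apply, smul_eq_mul]
    linarith
  · simp [hG, hy.2]

/-- If a polyhedron has a bounded projection with more than one point, then its homogenization
only contains points with nonnegative homogenizing coordinate. -/
theorem nonneg_of_homogenization (hb : Bornology.IsBounded (π '' {y | F y ≤ b ∧ G y = d}))
    (hnt : (π '' {y | F y ≤ b ∧ G y = d}).Nontrivial) {y : E} {l : ℝ}
    (hF : F y ≤ l • b) (hG : G y = l • d) : 0 ≤ l := by
  by_contra! hl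
  have key : ∀ z, F z ≤ b ∧ G z = d → π z = l⁻¹ • π y := by
    intro z hz
    have h0 : π (y - l • z) = 0 := by
      refine map_eq_zero_of_recession hb hz ?_ ?_
      · intro i
        have h1 := hF i
        have h2 := mul_le_mul_of_nonpos_left (hz.1 i) hl.le
        simp only [map_sub, map_smul, Pi.sub_apply, Pi.smul_apply, smul_eq_mul,
          Pi.zero_apply] at h1 ⊢
        linarith
      · simp [hG, hz.2]
    rw [map_sub, map_smul, sub_eq_zero] at h0
    rw [h0, smul_smul, inv_mul_cancel₀ hl.ne, one_smul]
  obtain ⟨_, ⟨z₁, hz₁, rfl⟩, _, ⟨z₂, hz₂, rfl⟩, hne⟩ := hnt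
  exact hne ((key z₁ hz₁).trans (key z₂ hz₂).symm)

/-- A point of the homogenization with coordinate `l ≥ 0` projects to the `l`-fold multiple of
a point of the projection. -/
theorem exists_smul_eq_of_homogenization
    (hb : Bornology.IsBounded (π '' {y | F y ≤ b ∧ G y = d}))
    (hne : (π '' {y | F y ≤ b ∧ G y = d}).Nonempty) {y : E} {l : ℝ} (hl : 0 ≤ l)
    (hF : F y ≤ l • b) (hG : G y = l • d) :
    ∃ x ∈ π '' {y | F y ≤ b ∧ G y = d}, l • x = π y := by
  rcases hl.eq_or_lt with rfl | hl
  · obtain ⟨_, z, hz, rfl⟩ := hne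
    refine ⟨π z, ⟨z, hz, rfl⟩, ?_⟩
    rw [map_eq_zero_of_recession (r := y) hb hz (by simpa using hF) (by simpa using hG), zero_smul]
  · refine ⟨_, ⟨l⁻¹ • y, ⟨?_, ?_⟩, rfl⟩, ?_⟩
    · intro i
      have h1 := mul_le_mul_of_nonneg_left (hF i) (inv_nonneg.2 hl.le)
      simpa [hl.ne'] using h1
    · rw [map_smul, hG, smul_smul, inv_mul_cancel₀ hl.ne', one_smul]
    · rw [map_smul, smul_smul, mul_inv_cancel₀ hl.ne', one_smul]

end Homogenization

/-- Disjunctive programming: an extended formulation of the convex hull of a union, where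
nonnegativity of the multiplier is imposed only for the singletons. -/
theorem IsExtFormulation.convexHull_iUnion {p k : ℕ} {P : Fin k → Set (Fin p → ℝ)} {m : Fin k → ℕ}
    (hP : ∀ i, IsExtFormulation (P i) (m i)) (hb : ∀ i, Bornology.IsBounded (P i))
    (hne : ∀ i, (P i).Nonempty) :
    IsExtFormulation (convexHull ℝ (⋃ i, P i))
      ((∑ i, m i) + Nat.card {i : Fin k // ∃ x, P i = {x}}) := by
  choose q s A b C d π h using hP
  let E := (i : Fin k) → (Fin (q i) → ℝ) × ℝ
  let pt (i : Fin k) : E →ₗ[ℝ] Fin (q i) → ℝ := LinearMap.fst ℝ _ _ ∘ₗ LinearMap.proj i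
  let mult (i : Fin k) : E →ₗ[ℝ] ℝ := LinearMap.snd ℝ _ _ ∘ₗ LinearMap.proj i
  let F : E →ₗ[ℝ] ((Σ i, Fin (m i)) ⊕ {i : Fin k // ∃ x, P i = {x}}) → ℝ :=
    LinearMap.pi (Sum.elim
      (fun j => LinearMap.proj j.2 ∘ₗ ((A j.1).mulVecLin ∘ₗ pt j.1 - (mult j.1).smulRight (b j.1)))
      (fun i => -mult i))
  let G : E →ₗ[ℝ] ((Σ i, Fin (s i)) ⊕ Unit) → ℝ :=
    LinearMap.pi (Sum.elim
      (fun j => LinearMap.proj j.2 ∘ₗ ((C j.1).mulVecLin ∘ₗ pt j.1 - (mult j.1).smulRight (d j.1)))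
      (fun _ => ∑ i, mult i))
  let proj : E →ₗ[ℝ] Fin p → ℝ := ∑ i, π i ∘ₗ pt i
  have hext := isExtFormulation_of_linearMap F 0 G (Sum.elim (fun _ => 0) fun _ => 1) proj
  have hcard : Nat.card ((Σ i, Fin (m i)) ⊕ {i : Fin k // ∃ x, P i = {x}}) =
      (∑ i, m i) + Nat.card {i : Fin k // ∃ x, P i = {x}} := by
    simp [Nat.card_sum]
  rw [hcard] at hext
  have hpt : ∀ i y, pt i y = (y i).1 := fun _ _ => rfl
  have hmult : ∀ i y, mult i y = (y i).2 := fun _ _ => rfl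
  have hfeas : ∀ y : E, (F y ≤ 0 ∧ G y = Sum.elim (fun _ => 0) fun _ => 1) ↔
      ((∀ i, (A i).mulVec (y i).1 ≤ (y i).2 • b i) ∧ ∀ i, (∃ x, P i = {x}) → 0 ≤ (y i).2) ∧
      (∀ i, (C i).mulVec (y i).1 = (y i).2 • d i) ∧ ∑ i, (y i).2 = 1 := by
    intro y
    simp [F, G, hpt, hmult, Pi.le_def, funext_iff, sub_eq_zero, Sigma.forall]
  have hproj : ∀ y : E, proj y = ∑ i, π i (y i).1 := fun y => by simp [proj, hpt]
  convert hext using 1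
  apply Set.Subset.antisymm
  · refine convexHull_min (Set.iUnion_subset fun i x hx => ?_) (Convex.linear_image ?_ proj)
    · rw [← h i] at hx
      obtain ⟨z, ⟨hz1, hz2⟩, rfl⟩ := hx
      have hy : ∀ j, j ≠ i → (Pi.single i (z, (1 : ℝ)) : E) j = 0 := fun j hj =>
        Pi.single_eq_of_ne hj _
      have hyi : (Pi.single i (z, (1 : ℝ)) : E) i = (z, 1) := Pi.single_eq_same _ _
      refine ⟨(Pi.single i (z, (1 : ℝ)) : E), (hfeas _).2 ⟨⟨fun j => ?_, fun j _ => ?_⟩,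
        fun j => ?_, ?_⟩, ?_⟩
      · rcases eq_or_ne j i with rfl | hj
        · simpa [hyi] using hz1
        · simp [hy j hj]
      · rcases eq_or_ne j i with rfl | hj
        · simp
        · simp [hy j hj]
      · rcases eq_or_ne j i with rfl | hj
        · simpa [hyi] using hz2
        · simp [hy j hj]
      · rw [Finset.sum_eq_single i (fun j _ hj => by simp [hy j hj]) (by simp), hyi]
      · rw [hproj, Finset.sum_eq_single i (fun j _ hj => by simp [hy j hj]) (by simp), hyi]
    · exact ((convex_Iic _).linear_preimage F).inter ((convex_singleton _).linear_preimage G)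
  · rintro _ ⟨y, hy, rfl⟩
    obtain ⟨⟨hA, hs⟩, hC, hsum⟩ := (hfeas y).1 hy
    have himg : ∀ i, π i '' {z | (A i).mulVecLin z ≤ b i ∧ (C i).mulVecLin z = d i} = P i := h
    have hnonneg : ∀ i, 0 ≤ (y i).2 := by
      intro i
      by_cases hi : ∃ x, P i = {x}
      · exact hs i hi
      · have hnt : (P i).Nontrivial :=
          (hne i).exists_eq_singleton_or_nontrivial.resolve_left hi
        exact nonneg_of_homogenization ((himg i).symm ▸ hb i) ((himg i).symm ▸ hnt) (hA i) (hC i)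
    have hpts : ∀ i, ∃ x ∈ P i, (y i).2 • x = π i (y i).1 := by
      intro i
      rw [← himg i]
      exact exists_smul_eq_of_homogenization ((himg i).symm ▸ hb i) ((himg i).symm ▸ hne i)
        (hnonneg i) (hA i) (hC i)
    choose x hx hxy using hpts
    rw [hproj, ← Finset.sum_congr rfl fun i _ => hxy i]
    exact (convex_convexHull ℝ _).sum_mem (fun i _ => hnonneg i) hsum fun i _ =>
      subset_convexHull ℝ _ (Set.mem_iUnion.2 ⟨i, hx i⟩)

/-- For nonempty polytopes `P₁, …, P_k ⊆ ℝ^p`,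
`xc(conv(P₁ ∪ ⋯ ∪ P_k)) ≤ Σᵢ xc(Pᵢ) + #{i : Pᵢ is a singleton}`. -/
theorem stmt1 {p k : ℕ} (P : Fin k → Set (Fin p → ℝ))
    (hpoly : ∀ i, IsPolytope (P i)) (hne : ∀ i, (P i).Nonempty) :
    xc (convexHull ℝ (⋃ i, P i)) ≤
      (∑ i, xc (P i)) + Nat.card {i : Fin k // ∃ x, P i = {x}} := by
  exact Nat.sInf_le (IsExtFormulation.convexHull_iUnion
    (fun i => (hpoly i).isExtFormulation_xc) (fun i => (hpoly i).isBounded) hne)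
end

section
/- Let P ⊆ ℝ^p be a 0/1-polytope containing at least two distinct points (equivalently, dim(P) ≥ 1), and let v ∈ {0,1}^p with v ∉ P. Then xcs(conv(P ∪ {v})) ≤ xcs(P) + 1. -/
/-- A 0/1-vector. -/
def IsZeroOneVec {ι : Type*} (x : ι → ℝ) : Prop := ∀ i, x i = 0 ∨ x i = 1

/-- A 0/1-polytope: the convex hull of a set of 0/1-vectors. -/
def IsZeroOnePolytope {ι : Type*} (Q : Set (ι → ℝ)) : Prop :=
  ∃ V : Set (ι → ℝ), (∀ x ∈ V, IsZeroOneVec x) ∧ Q = convexHull ℝ V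

/-- `(Q, π)` is a nice 0/1-extension of `P`: `Q` is a 0/1-polytope, `π(Q) = P`,
every vertex (extreme point) of `Q` projects to a vertex of `P`, and each vertex
of `P` has exactly one vertex of `Q` projecting onto it. -/
def IsNiceExtension {p : ℕ} {ι : Type*} (P : Set (Fin p → ℝ)) (Q : Set (ι → ℝ))
    (π : (ι → ℝ) →ₗ[ℝ] (Fin p → ℝ)) : Prop :=
  IsZeroOnePolytope Q ∧ π '' Q = P ∧
    (∀ y ∈ Set.extremePoints ℝ Q, π y ∈ Set.extremePoints ℝ P) ∧
    (∀ v ∈ Set.extremePoints ℝ P, ∃! y, y ∈ Set.extremePoints ℝ Q ∧ π y = v)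

/-- `P` has a nice 0/1-extension `(Q, π)` where `Q` is described by `m` linear
inequalities together with finitely many linear equations. -/
def HasNiceDescrOfSize {p : ℕ} (P : Set (Fin p → ℝ)) (m : ℕ) : Prop :=
  ∃ (q s : ℕ) (A : Matrix (Fin m) (Fin q) ℝ) (b : Fin m → ℝ)
    (C : Matrix (Fin s) (Fin q) ℝ) (d : Fin s → ℝ)
    (π : (Fin q → ℝ) →ₗ[ℝ] (Fin p → ℝ)),
    IsNiceExtension P {y | A.mulVec y ≤ b ∧ C.mulVec y = d} π

/-- The smallest size of a description of `Q` over all nice 0/1-extensions `(Q, π)` of `P`. -/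
noncomputable def xcs {p : ℕ} (P : Set (Fin p → ℝ)) : ℕ :=
  sInf {m | HasNiceDescrOfSize P m}

theorem convexHull_subset_Icc_of_isZeroOneVec {ι : Type*} {V : Set (ι → ℝ)}
    (hV : ∀ x ∈ V, IsZeroOneVec x) : convexHull ℝ V ⊆ Set.Icc 0 1 := by
  refine convexHull_min (fun z hz => ⟨fun i => ?_, fun i => ?_⟩) (convex_Icc 0 1) <;>
    rcases hV z hz i with h | h <;> simp [h]

theorem mem_extremePoints_convexHull_of_isZeroOneVec {ι : Type*} {V : Set (ι → ℝ)}
    (hV : ∀ x ∈ V, IsZeroOneVec x) {x : ι → ℝ} (hx : x ∈ V) :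
    x ∈ Set.extremePoints ℝ (convexHull ℝ V) := by
  have hsub := convexHull_subset_Icc_of_isZeroOneVec hV
  refine ⟨subset_convexHull ℝ V hx, ?_⟩
  rintro y hy z hz ⟨a, b, ha, hb, hab, rfl⟩
  obtain ⟨hy0, hy1⟩ := hsub hy
  obtain ⟨hz0, hz1⟩ := hsub hz
  funext i
  have h := hV _ hx i
  have y0 := hy0 i
  have y1 := hy1 i
  have z0 := hz0 i
  have z1 := hz1 i
  simp only [Pi.add_apply, Pi.smul_apply, smul_eq_mul, Pi.zero_apply, Pi.one_apply] at *
  rcases h with h | h <;> rw [h]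
  · nlinarith [mul_nonneg hb.le z0, mul_nonneg ha.le y0]
  · nlinarith [mul_nonneg hb.le (sub_nonneg.2 z1), mul_nonneg ha.le (sub_nonneg.2 y1)]

/-- The extreme points of the hull of a set of 0/1-vectors are exactly these vectors. -/
theorem extremePoints_convexHull_of_isZeroOneVec {ι : Type*} {V : Set (ι → ℝ)}
    (hV : ∀ x ∈ V, IsZeroOneVec x) :
    Set.extremePoints ℝ (convexHull ℝ V) = V :=
  Set.Subset.antisymm extremePoints_convexHull_subset
    fun _ hx => mem_extremePoints_convexHull_of_isZeroOneVec hV hx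

/-- A linear map between 0/1-polytopes is a nice extension if and only if it restricts to a
bijection of the vertex sets. -/
theorem isNiceExtension_convexHull_iff {p : ℕ} {ι : Type*} {V : Set (Fin p → ℝ)}
    {W : Set (ι → ℝ)} (hV : ∀ x ∈ V, IsZeroOneVec x) (hW : ∀ x ∈ W, IsZeroOneVec x)
    (π : (ι → ℝ) →ₗ[ℝ] (Fin p → ℝ)) :
    IsNiceExtension (convexHull ℝ V) (convexHull ℝ W) π ↔ Set.BijOn π W V := by
  unfold IsNiceExtension
  rw [extremePoints_convexHull_of_isZeroOneVec hV, extremePoints_convexHull_of_isZeroOneVec hW]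
  constructor
  · rintro ⟨-, -, hmaps, huniq⟩
    refine ⟨hmaps, fun x hx y hy hxy => ?_, fun w hw => ?_⟩
    · exact (huniq _ (hmaps y hy)).unique ⟨hx, hxy⟩ ⟨hy, rfl⟩
    · exact (huniq w hw).exists
  · intro h
    refine ⟨⟨W, hW, rfl⟩, ?_, h.mapsTo, fun w hw => ?_⟩
    · rw [π.image_convexHull, h.image_eq]
    · obtain ⟨x, hx, rfl⟩ := h.surjOn hw
      exact ⟨x, ⟨hx, rfl⟩, fun y hy => h.injOn hy.1 hx hy.2⟩

/-- The hull of `n` distinct 0/1-vectors is a nice projection of the standard simplex. -/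
theorem exists_hasNiceDescrOfSize {p : ℕ} {V : Set (Fin p → ℝ)}
    (hV : ∀ x ∈ V, IsZeroOneVec x) : ∃ m, HasNiceDescrOfSize (convexHull ℝ V) m := by
  have hfin : V.Finite := by
    refine (Set.Finite.pi' (t := fun _ : Fin p => ({0, 1} : Set ℝ))
      fun _ => Set.toFinite _).subset fun x hx i => ?_
    simpa using hV x hx i
  have := hfin.fintype
  let e := (Fintype.equivFin V).symm
  refine ⟨Fintype.card V, Fintype.card V, 1, -1, 0, Matrix.of fun _ _ => 1, 1,
    Fintype.linearCombination ℝ fun i => (e i : Fin p → ℝ), ?_⟩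
  have hQ : {y : Fin (Fintype.card V) → ℝ |
      (-1 : Matrix (Fin (Fintype.card V)) _ ℝ).mulVec y ≤ 0 ∧
      (Matrix.of fun (_ : Fin 1) _ => (1 : ℝ)).mulVec y = 1} =
      convexHull ℝ (Set.range fun i => Pi.single i (1 : ℝ)) := by
    rw [convexHull_rangle_single_eq_stdSimplex]
    ext y
    simp [stdSimplex, Matrix.neg_mulVec, funext_iff, Matrix.mulVec, dotProduct, Pi.le_def]
  rw [hQ, isNiceExtension_convexHull_iff hV]
  · refine ⟨?_, ?_, fun x hx => ?_⟩
    · rintro _ ⟨i, rfl⟩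
      simp [Fintype.linearCombination_apply_single]
    · rintro _ ⟨i, rfl⟩ _ ⟨j, rfl⟩ h
      have hij : (e i : Fin p → ℝ) = e j := by
        simpa [Fintype.linearCombination_apply_single] using h
      rw [e.injective (Subtype.ext hij)]
    · refine ⟨_, ⟨e.symm ⟨x, hx⟩, rfl⟩, ?_⟩
      simp [Fintype.linearCombination_apply_single]
  · rintro _ ⟨i, rfl⟩ j
    by_cases h : j = i
    · subst h; simp
    · simp [h]

/-- The recession cone of a nonempty polyhedron contained in the hull of 0/1-vectors is trivial. -/
theorem eq_zero_of_recession {m q s : ℕ} {A : Matrix (Fin m) (Fin q) ℝ} {b : Fin m → ℝ}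
    {C : Matrix (Fin s) (Fin q) ℝ} {d : Fin s → ℝ} {W : Set (Fin q → ℝ)}
    (hW : ∀ x ∈ W, IsZeroOneVec x)
    (hQ : {y | A.mulVec y ≤ b ∧ C.mulVec y = d} = convexHull ℝ W)
    {x u : Fin q → ℝ} (hx : A.mulVec x ≤ b ∧ C.mulVec x = d)
    (hA : A.mulVec u ≤ 0) (hC : C.mulVec u = 0) : u = 0 := by
  have hsub := convexHull_subset_Icc_of_isZeroOneVec hW
  rw [← hQ] at hsub
  have hray : ∀ r : ℝ, 0 ≤ r → x + r • u ∈ Set.Icc (0 : Fin q → ℝ) 1 := by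
    intro r hr
    refine hsub ⟨?_, ?_⟩
    · rw [Matrix.mulVec_add, Matrix.mulVec_smul]
      intro i
      have h1 := hx.1 i
      have h2 := mul_nonneg hr (neg_nonneg.2 (hA i))
      simp only [Pi.add_apply, Pi.smul_apply, smul_eq_mul]
      linarith
    · rw [Matrix.mulVec_add, Matrix.mulVec_smul, hC, hx.2, smul_zero, add_zero]
  funext i
  by_contra hne
  have hx0 := (hsub hx).1 i
  have hx1 := (hsub hx).2 i
  have hpos : 0 < |u i| := abs_pos.2 hne
  obtain ⟨h0, h1⟩ := hray (2 / |u i|) (by positivity)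
  have h0 := h0 i
  have h1 := h1 i
  simp only [Pi.add_apply, Pi.smul_apply, smul_eq_mul, Pi.zero_apply, Pi.one_apply] at *
  rcases lt_or_gt_of_ne hne with h | h
  · rw [abs_of_neg h] at h0
    have : 2 / (-u i) * u i = -2 := by field_simp
    linarith
  · rw [abs_of_pos h] at h1
    have : 2 / u i * u i = 2 := by field_simp
    linarith

/-- The coefficient matrix of the homogenization of a linear system with coefficients `M` and
right-hand side `c`; the homogenizing coordinate comes first. -/
def homogenize {n q : ℕ} (M : Matrix (Fin n) (Fin q) ℝ) (c : Fin n → ℝ) :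
    Matrix (Fin n) (Fin (q + 1)) ℝ :=
  Matrix.of fun i => Fin.cons (c i) fun j => M i j

theorem homogenize_mulVec_cons {n q : ℕ} (M : Matrix (Fin n) (Fin q) ℝ) (c : Fin n → ℝ)
    (t : ℝ) (y : Fin q → ℝ) :
    (homogenize M c).mulVec (Fin.cons t y) = t • c + M.mulVec y := by
  funext i
  simp [homogenize, Matrix.mulVec, dotProduct, Fin.sum_univ_succ, mul_comm]

/-- The rows of `homogenize A b`, preceded by the row of the inequality `-t ≤ 0`. -/
def pyramidMatrix {m q : ℕ} (A : Matrix (Fin m) (Fin q) ℝ) (b : Fin m → ℝ) :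
    Matrix (Fin (m + 1)) (Fin (q + 1)) ℝ :=
  homogenize (Matrix.of (Fin.cons 0 fun i j => A i j)) (Fin.cons (-1) b)

theorem pyramidMatrix_mulVec_cons_le_iff {m q : ℕ} (A : Matrix (Fin m) (Fin q) ℝ)
    (b : Fin m → ℝ) (t : ℝ) (y : Fin q → ℝ) :
    (pyramidMatrix A b).mulVec (Fin.cons t y) ≤ Fin.cons 0 b ↔
      0 ≤ t ∧ t • b + A.mulVec y ≤ b := by
  rw [pyramidMatrix, homogenize_mulVec_cons, Pi.le_def, Fin.forall_fin_succ]
  refine and_congr ?_ ?_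
  · simp [Matrix.mulVec, dotProduct]
  · simp [Matrix.mulVec, dotProduct, Pi.le_def]

/-- The pyramid over a 0/1-polytope with at least two points is described by the homogenized
system together with the single inequality `0 ≤ t`. -/
theorem pyramid_eq_convexHull {m q s : ℕ} {A : Matrix (Fin m) (Fin q) ℝ} {b : Fin m → ℝ}
    {C : Matrix (Fin s) (Fin q) ℝ} {d : Fin s → ℝ} {W : Set (Fin q → ℝ)}
    (hW : ∀ x ∈ W, IsZeroOneVec x)
    (hQ : {y | A.mulVec y ≤ b ∧ C.mulVec y = d} = convexHull ℝ W)
    {x₁ x₂ : Fin q → ℝ} (hx₁ : x₁ ∈ convexHull ℝ W) (hx₂ : x₂ ∈ convexHull ℝ W)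
    (hne : x₁ ≠ x₂) :
    {z | (pyramidMatrix A b).mulVec z ≤ Fin.cons 0 b ∧ (homogenize C d).mulVec z = d} =
    convexHull ℝ ((Fin.cons 0 '' W) ∪ {Fin.cons 1 0}) := by
  have hmem : ∀ (t : ℝ) (y : Fin q → ℝ), (Fin.cons t y : Fin (q + 1) → ℝ) ∈
      {z | (pyramidMatrix A b).mulVec z ≤ Fin.cons 0 b ∧ (homogenize C d).mulVec z = d} ↔
      0 ≤ t ∧ t • b + A.mulVec y ≤ b ∧ t • d + C.mulVec y = d := by
    intro t y
    rw [Set.mem_ofPred_eq, homogenize_mulVec_cons, pyramidMatrix_mulVec_cons_le_iff, and_assoc]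
  apply Set.Subset.antisymm
  · intro z hz
    obtain ⟨t, y, rfl⟩ : ∃ t y, z = (Fin.cons t y : Fin (q + 1) → ℝ) :=
      ⟨z 0, Fin.tail z, (Fin.cons_self_tail z).symm⟩
    obtain ⟨ht, hA, hC⟩ := (hmem t y).1 hz
    rw [← hQ] at hx₁ hx₂
    have hapex : (Fin.cons 1 0 : Fin (q + 1) → ℝ) ∈
        convexHull ℝ ((Fin.cons 0 '' W) ∪ {Fin.cons 1 0}) :=
      subset_convexHull ℝ _ (Or.inr rfl)
    rcases lt_trichotomy t 1 with h | rfl | h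
    · have hs : 0 < 1 - t := by linarith
      have hbase : (1 - t)⁻¹ • y ∈ convexHull ℝ W := by
        rw [← hQ]
        refine ⟨?_, ?_⟩
        · rw [Matrix.mulVec_smul]
          intro i
          have := hA i
          simp only [Pi.add_apply, Pi.smul_apply, smul_eq_mul] at this ⊢
          rw [inv_mul_le_iff₀ hs]
          linarith
        · rw [Matrix.mulVec_smul, inv_smul_eq_iff₀ hs.ne', sub_smul, one_smul]
          exact eq_sub_of_add_eq' hC
      let f : (Fin q → ℝ) →ₗ[ℝ] (Fin (q + 1) → ℝ) :=
        { toFun := fun y => Fin.cons 0 y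
          map_add' := fun a b => by
            funext i; refine Fin.cases ?_ (fun _ => ?_) i <;> simp
          map_smul' := fun a b => by
            funext i; refine Fin.cases ?_ (fun _ => ?_) i <;> simp }
      have hbase' : f ((1 - t)⁻¹ • y) ∈
          convexHull ℝ ((Fin.cons 0 '' W) ∪ {(Fin.cons 1 0 : Fin (q + 1) → ℝ)}) := by
        refine convexHull_mono Set.subset_union_left ?_
        have := Set.mem_image_of_mem f hbase
        rwa [f.image_convexHull] at this
      convert convex_convexHull ℝ _ hbase' hapex hs.le ht (by ring) using 1
      funext i
      refine Fin.cases ?_ (fun j => ?_) i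
      · simp [f]
      · simp [f, hs.ne']
    · have : y = 0 := by
        refine eq_zero_of_recession hW hQ hx₁ ?_ ?_
        · simpa using hA
        · simpa using hC
      rwa [this]
    · exfalso
      have hs : 0 < t - 1 := by linarith
      have key : ∀ x, A.mulVec x ≤ b ∧ C.mulVec x = d → (t - 1) • x + y = 0 := by
        intro x hx
        refine eq_zero_of_recession hW hQ hx₁ ?_ ?_
        · rw [Matrix.mulVec_add, Matrix.mulVec_smul]
          intro i
          have h1 := hA i
          have h2 := mul_le_mul_of_nonneg_left (hx.1 i) hs.le
          simp only [Pi.add_apply, Pi.smul_apply, smul_eq_mul, Pi.zero_apply] at h1 ⊢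
          linarith
        · rw [Matrix.mulVec_add, Matrix.mulVec_smul, hx.2, eq_sub_of_add_eq' hC, sub_smul,
            one_smul]
          abel
      have h12 : (t - 1) • x₁ = (t - 1) • x₂ :=
        add_right_cancel ((key x₁ hx₁).trans (key x₂ hx₂).symm)
      exact hne (smul_right_injective _ hs.ne' h12)
  · refine convexHull_min ?_ ?_
    · rintro _ (⟨y, hy, rfl⟩ | rfl)
      · have hy' := subset_convexHull ℝ W hy
        rw [← hQ] at hy'
        rw [hmem]
        simpa using hy'
      · rw [hmem]
        simp
    · rintro x ⟨hx, hx'⟩ y ⟨hy, hy'⟩ α β hα hβ hαβ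
      refine ⟨?_, ?_⟩
      · rw [Matrix.mulVec_add, Matrix.mulVec_smul, Matrix.mulVec_smul]
        exact convex_Iic (𝕜 := ℝ) (Fin.cons 0 b : Fin (m + 1) → ℝ) hx hy hα hβ hαβ
      · rw [Matrix.mulVec_add, Matrix.mulVec_smul, Matrix.mulVec_smul, hx', hy', ← add_smul,
          hαβ, one_smul]

theorem HasNiceDescrOfSize.insert_vertex {p m : ℕ} {V : Set (Fin p → ℝ)}
    (hV : ∀ x ∈ V, IsZeroOneVec x)
    (h2 : ∃ x ∈ convexHull ℝ V, ∃ y ∈ convexHull ℝ V, x ≠ y) {v : Fin p → ℝ}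
    (hv01 : IsZeroOneVec v) (hv : v ∉ V) (h : HasNiceDescrOfSize (convexHull ℝ V) m) :
    HasNiceDescrOfSize (convexHull ℝ (V ∪ {v})) (m + 1) := by
  obtain ⟨q, s, A, b, C, d, π, hnice⟩ := h
  obtain ⟨W, hW, hQ⟩ := hnice.1
  rw [hQ, isNiceExtension_convexHull_iff hV hW] at hnice
  obtain ⟨x, hx, y, hy, hxy⟩ := h2
  rw [← hnice.image_eq, ← π.image_convexHull] at hx hy
  obtain ⟨x, hx, rfl⟩ := hx
  obtain ⟨y, hy, rfl⟩ := hy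
  have hpyr := pyramid_eq_convexHull hW hQ hx hy fun h => hxy (congrArg π h)
  let π' : (Fin (q + 1) → ℝ) →ₗ[ℝ] (Fin p → ℝ) :=
    π ∘ₗ LinearMap.funLeft ℝ ℝ Fin.succ + (LinearMap.proj 0).smulRight v
  have hπ' : ∀ (t : ℝ) (y : Fin q → ℝ), π' (Fin.cons t y) = π y + t • v := by
    intro t y
    have : LinearMap.funLeft ℝ ℝ Fin.succ (Fin.cons t y : Fin (q + 1) → ℝ) = y := by
      funext i; simp [LinearMap.funLeft_apply]
    simp [π', this]
  refine ⟨q + 1, s, pyramidMatrix A b, Fin.cons 0 b, homogenize C d, d, π', ?_⟩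
  rw [hpyr, isNiceExtension_convexHull_iff]
  · refine ⟨?_, ?_, ?_⟩
    · rintro _ (⟨w, hw, rfl⟩ | rfl)
      · left
        simpa [hπ'] using hnice.mapsTo hw
      · right
        simp [hπ']
    · rintro _ (⟨w, hw, rfl⟩ | rfl) _ (⟨w', hw', rfl⟩ | rfl) h <;>
        simp only [hπ', zero_smul, add_zero, map_zero, one_smul, zero_add] at h
      · rw [hnice.injOn hw hw' h]
      · exact absurd (h ▸ hnice.mapsTo hw) hv
      · exact absurd (h ▸ hnice.mapsTo hw') hv
      · rfl
    · rintro _ (hw | rfl)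
      · obtain ⟨w, hwW, rfl⟩ := hnice.surjOn hw
        exact ⟨_, Or.inl ⟨w, hwW, rfl⟩, by simp [hπ']⟩
      · exact ⟨_, Or.inr rfl, by simp [hπ']⟩
  · rintro w (hw | rfl)
    · exact hV w hw
    · exact hv01
  · rintro _ (⟨w, hw, rfl⟩ | rfl) i
    · refine Fin.cases (by simp) (fun j => ?_) i
      simpa using hW w hw j
    · refine Fin.cases (by simp) (fun j => ?_) i
      simp

/-- For a 0/1-polytope `P ⊆ ℝ^p` with at least two distinct
points and a 0/1-point `v ∉ P`, `xcs(conv(P ∪ {v})) ≤ xcs(P) + 1`. -/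
theorem stmt4 {p : ℕ} (P : Set (Fin p → ℝ)) (h01 : IsZeroOnePolytope P)
    (h2 : ∃ x ∈ P, ∃ y ∈ P, x ≠ y)
    (v : Fin p → ℝ) (hv01 : IsZeroOneVec v) (hv : v ∉ P) :
    xcs (convexHull ℝ (P ∪ {v})) ≤ xcs P + 1 := by
  obtain ⟨V, hV, rfl⟩ := h01
  have hmin : HasNiceDescrOfSize (convexHull ℝ V) (xcs (convexHull ℝ V)) :=
    Nat.sInf_mem (exists_hasNiceDescrOfSize hV)
  have hvV : v ∉ V := fun h => hv (subset_convexHull ℝ V h)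
  have hhull : convexHull ℝ (convexHull ℝ V ∪ {v}) = convexHull ℝ (V ∪ {v}) :=
    (convexHull ℝ).closure_sup_closure_left V {v}
  rw [hhull]
  exact Nat.sInf_le (hmin.insert_vertex hV h2 hv01 hvV)
end

section
/- Let P ⊆ ℝ^p be a polytope whose affine hull has dimension d ≥ 1. Then xc(P) = d + 1 if and only if P is a d-simplex, i.e., P is the convex hull of d + 1 affinely independent points. -/
/-- If `g` kills every vector on which `f` is nonnegative, then `g` factors through `f`. -/
theorem ker_le_ker_of_nonneg {K E : Type*} [AddCommGroup K] [Module ℝ K] [AddCommGroup E]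
    [Module ℝ E] {m : ℕ} (f : K →ₗ[ℝ] (Fin m → ℝ)) (g : K →ₗ[ℝ] E)
    (h : ∀ w, 0 ≤ f w → g w = 0) : LinearMap.ker f ≤ LinearMap.ker g := fun w hw =>
  h w (LinearMap.mem_ker.1 hw).ge

/-- A nonzero linear map killing every vector on which `f` is nonnegative
prevents `f` from being surjective. -/
theorem range_ne_top_of_nonneg {K E : Type*} [AddCommGroup K] [Module ℝ K] [AddCommGroup E]
    [Module ℝ E] {m : ℕ} (f : K →ₗ[ℝ] (Fin m → ℝ)) (g : K →ₗ[ℝ] E)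
    (h : ∀ w, 0 ≤ f w → g w = 0) (hg : g ≠ 0) : LinearMap.range f ≠ ⊤ := by
  intro htop
  have hsurj := LinearMap.range_eq_top.1 htop
  choose e he using fun i : Fin m => hsurj (Pi.single i 1)
  apply hg
  ext w
  have hw : w - ∑ i, f w i • e i ∈ LinearMap.ker f := by
    rw [LinearMap.mem_ker, map_sub, map_sum, sub_eq_zero]
    simp only [map_smul, he]
    exact pi_eq_sum_univ' (f w)
  have := ker_le_ker_of_nonneg f g h hw
  rw [LinearMap.mem_ker, map_sub, map_sum, sub_eq_zero] at this
  rw [this]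
  refine Finset.sum_eq_zero fun i _ => ?_
  rw [map_smul, h (e i) (by rw [he]; exact Pi.single_nonneg.2 zero_le_one), smul_zero]

open Module in
theorem finrank_range_le_of_ker_le {K E F : Type*} [AddCommGroup K] [Module ℝ K]
    [FiniteDimensional ℝ K] [AddCommGroup E] [Module ℝ E] [AddCommGroup F] [Module ℝ F]
    (f : K →ₗ[ℝ] F) (g : K →ₗ[ℝ] E) (h : LinearMap.ker f ≤ LinearMap.ker g) :
    finrank ℝ (LinearMap.range g) ≤ finrank ℝ (LinearMap.range f) := by
  have h1 := f.finrank_range_add_finrank_ker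
  have h2 := g.finrank_range_add_finrank_ker
  have h3 := Submodule.finrank_mono h
  omega

open Module in
theorem lt_of_le_finrank_range {K E : Type*} [AddCommGroup K] [Module ℝ K]
    [FiniteDimensional ℝ K] [AddCommGroup E] [Module ℝ E] {m d : ℕ}
    (f : K →ₗ[ℝ] (Fin m → ℝ)) (g : K →ₗ[ℝ] E) (h : ∀ w, 0 ≤ f w → g w = 0)
    (hd : d ≤ finrank ℝ (LinearMap.range g)) (hd1 : 1 ≤ d) : d < m := by
  have hg : g ≠ 0 := by
    rintro rfl
    rw [LinearMap.range_zero, finrank_bot] at hd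
    omega
  have h1 := finrank_range_le_of_ker_le f g (ker_le_ker_of_nonneg f g h)
  have h2 := Submodule.finrank_lt (range_ne_top_of_nonneg f g h hg)
  rw [finrank_fin_fun] at h2
  omega

open Module in
/-- A hyperplane of `ℝ^m` meeting the nonnegative orthant only at the origin
has a strictly positive normal vector. -/
theorem exists_pos_normal {d : ℕ} (W : Submodule ℝ (Fin (d + 1) → ℝ)) (hW : finrank ℝ W = d)
    (h : ∀ x ∈ W, 0 ≤ x → x = 0) :
    ∃ a : Fin (d + 1) → ℝ, (∀ i, 0 < a i) ∧ ∀ x, x ∈ W ↔ a ⬝ᵥ x = 0 := by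
  have hlt : W < ⊤ := by
    refine lt_top_iff_ne_top.2 fun ht => ?_
    rw [ht, finrank_top, finrank_fin_fun] at hW
    omega
  obtain ⟨φ, hφ, hle⟩ := W.exists_le_ker_of_lt_top hlt
  have hker : W = LinearMap.ker φ := by
    refine Submodule.eq_of_le_of_finrank_le hle ?_
    have h1 := Submodule.finrank_lt (mt LinearMap.ker_eq_top.1 hφ)
    rw [finrank_fin_fun] at h1
    omega
  set a : Fin (d + 1) → ℝ := fun i => φ (Pi.single i 1) with ha
  have hsingle : ∀ i c, φ (Pi.single i c) = c * a i := fun i c => by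
    rw [ha, ← smul_eq_mul, ← map_smul, ← Pi.single_smul', smul_eq_mul, mul_one]
  have hφa : ∀ x, φ x = a ⬝ᵥ x := fun x => by
    conv_lhs => rw [pi_eq_sum_univ' x]
    simp [dotProduct, ha, mul_comm]
  have hne : ∀ i, a i ≠ 0 := fun i hi => by
    have := h (Pi.single i 1) (by rw [hker, LinearMap.mem_ker, hsingle, hi, mul_zero])
      (Pi.single_nonneg.2 zero_le_one)
    simp at this
  refine ⟨a 0 • a, fun i => ?_, fun x => ?_⟩
  · by_contra! hneg
    rw [Pi.smul_apply, smul_eq_mul] at hneg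
    have h0 : i ≠ 0 := by
      rintro rfl
      exact hne 0 (mul_self_eq_zero.1 (le_antisymm hneg (mul_self_nonneg _)))
    have := h (Pi.single 0 (a i ^ 2) + Pi.single i (-(a 0 * a i)))
      (by rw [hker, LinearMap.mem_ker, map_add, hsingle, hsingle]; ring)
      (add_nonneg (Pi.single_nonneg.2 (sq_nonneg _)) (Pi.single_nonneg.2 (by linarith)))
    have := congrFun this 0
    simp [h0.symm, hne i] at this
  · rw [hker, LinearMap.mem_ker, hφa, smul_dotProduct, smul_eq_mul, mul_eq_zero,
      or_iff_right (hne 0)]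

open Module in
theorem exists_pos_normal_of_range {K E : Type*} [AddCommGroup K] [Module ℝ K]
    [FiniteDimensional ℝ K] [AddCommGroup E] [Module ℝ E] {d : ℕ}
    (f : K →ₗ[ℝ] (Fin (d + 1) → ℝ)) (g : K →ₗ[ℝ] E) (h : ∀ w, 0 ≤ f w → g w = 0)
    (hd : d ≤ finrank ℝ (LinearMap.range g)) (hd1 : 1 ≤ d) :
    ∃ a : Fin (d + 1) → ℝ, (∀ i, 0 < a i) ∧ ∀ x, x ∈ LinearMap.range f ↔ a ⬝ᵥ x = 0 := by
  have hg : g ≠ 0 := by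
    rintro rfl
    rw [LinearMap.range_zero, finrank_bot] at hd
    omega
  have hk := ker_le_ker_of_nonneg f g h
  have h1 := finrank_range_le_of_ker_le f g hk
  have h2 := Submodule.finrank_lt (range_ne_top_of_nonneg f g h hg)
  rw [finrank_fin_fun] at h2
  have h3 := f.finrank_range_add_finrank_ker
  have h4 := g.finrank_range_add_finrank_ker
  have hkk : LinearMap.ker f = LinearMap.ker g :=
    Submodule.eq_of_le_of_finrank_le hk (by omega)
  refine exists_pos_normal _ (by omega) ?_
  rintro _ ⟨w, rfl⟩ hw
  rw [← LinearMap.mem_ker, hkk]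
  exact h w hw

theorem eq_zero_of_bounded_ray {E : Type*} [NormedAddCommGroup E] [NormedSpace ℝ E] {P : Set E}
    (hP : Bornology.IsBounded P) (x v : E) (h : ∀ t : ℝ, 0 ≤ t → x + t • v ∈ P) : v = 0 := by
  obtain ⟨R, hR⟩ := hP.exists_norm_le
  by_contra hv
  have hv' := norm_pos_iff.2 hv
  have hx : 0 ≤ R := (norm_nonneg _).trans (hR _ (h 0 le_rfl))
  have h0 : 0 ≤ (R + ‖x‖ + 1) / ‖v‖ := by positivity
  have h1 := hR _ (h _ h0)
  have h2 : ‖((R + ‖x‖ + 1) / ‖v‖) • v‖ = R + ‖x‖ + 1 := by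
    rw [norm_smul, Real.norm_of_nonneg h0, div_mul_cancel₀ _ hv'.ne']
  have h3 := norm_le_norm_add_norm_sub' (((R + ‖x‖ + 1) / ‖v‖) • v)
    (x + ((R + ‖x‖ + 1) / ‖v‖) • v)
  have h4 : ((R + ‖x‖ + 1) / ‖v‖) • v - (x + ((R + ‖x‖ + 1) / ‖v‖) • v) = -x := by abel
  rw [h4, norm_neg] at h3
  linarith

/-- The linear data of an extended formulation of a bounded set, based at a feasible point:
`K` is the direction space of the equations and `f` is the change of slack. -/
theorem IsExtFormulation.exists_slack {p m d : ℕ} {P : Set (Fin p → ℝ)}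
    (hP : Bornology.IsBounded P) (hne : P.Nonempty)
    (hd : Module.finrank ℝ (vectorSpan ℝ P) = d) (h : IsExtFormulation P m) :
    ∃ (q : ℕ) (K : Submodule ℝ (Fin q → ℝ)) (f : K →ₗ[ℝ] (Fin m → ℝ))
      (g : K →ₗ[ℝ] (Fin p → ℝ)) (x₀ : Fin m → ℝ) (z₀ : Fin p → ℝ),
      (∀ w, 0 ≤ f w → g w = 0) ∧ d ≤ Module.finrank ℝ (LinearMap.range g) ∧ 0 ≤ x₀ ∧
      ∀ z, z ∈ P ↔ ∃ w, 0 ≤ x₀ + f w ∧ z₀ + g w = z := by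
  obtain ⟨q, s, A, b, C, c, π, rfl⟩ := h
  obtain ⟨_, y₀, ⟨hA, hC⟩, rfl⟩ := hne
  set K := LinearMap.ker C.mulVecLin
  let f : K →ₗ[ℝ] (Fin m → ℝ) := -(A.mulVecLin.domRestrict K)
  let g : K →ₗ[ℝ] (Fin p → ℝ) := π.domRestrict K
  have hf : ∀ w : K, f w = -A.mulVec w := fun w => rfl
  have hg : ∀ w : K, g w = π w := fun w => rfl
  have hmem : ∀ z, z ∈ π '' {y | A.mulVec y ≤ b ∧ C.mulVec y = c} ↔
      ∃ w, 0 ≤ (b - A.mulVec y₀) + f w ∧ π y₀ + g w = z := by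
    intro z
    constructor
    · rintro ⟨y, ⟨h1, h2⟩, rfl⟩
      have hw : y - y₀ ∈ K := by
        rw [LinearMap.mem_ker, Matrix.mulVecLin_apply, Matrix.mulVec_sub, h2, hC, sub_self]
      refine ⟨⟨y - y₀, hw⟩, ?_, ?_⟩
      · rw [hf, Matrix.mulVec_sub]
        have : b - A.mulVec y₀ + -(A.mulVec y - A.mulVec y₀) = b - A.mulVec y := by abel
        rw [this]
        exact sub_nonneg.2 h1
      · rw [hg, map_sub, add_sub_cancel]
    · rintro ⟨w, h1, rfl⟩
      have hw : C.mulVec (w : Fin q → ℝ) = 0 := w.2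
      refine ⟨y₀ + w, ⟨?_, ?_⟩, by rw [map_add, hg]⟩
      · rw [hf] at h1
        rw [Matrix.mulVec_add, ← sub_nonneg]
        convert h1 using 1
        abel
      · rw [Matrix.mulVec_add, hC, hw, add_zero]
  refine ⟨q, K, f, g, b - A.mulVec y₀, π y₀, fun w hw => ?_, ?_, sub_nonneg.2 hA, hmem⟩
  · refine eq_zero_of_bounded_ray hP (π y₀) (g w) fun t ht => (hmem _).2 ⟨t • w, ?_, ?_⟩
    · rw [map_smul]
      exact add_nonneg (sub_nonneg.2 hA) (smul_nonneg ht hw)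
    · rw [map_smul]
  · rw [← hd]
    refine Submodule.finrank_mono (Submodule.span_le.2 ?_)
    rintro _ ⟨u, hu, v, hv, rfl⟩
    obtain ⟨w, -, rfl⟩ := (hmem u).1 hu
    obtain ⟨w', -, rfl⟩ := (hmem v).1 hv
    exact ⟨w - w', by simp⟩

theorem IsExtFormulation.lt {p m d : ℕ} {P : Set (Fin p → ℝ)}
    (hP : Bornology.IsBounded P) (hne : P.Nonempty)
    (hd : Module.finrank ℝ (vectorSpan ℝ P) = d) (hd1 : 1 ≤ d) (h : IsExtFormulation P m) :
    d < m := by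
  obtain ⟨q, K, f, g, x₀, z₀, hfg, hdg, -, -⟩ := h.exists_slack hP hne hd
  exact lt_of_le_finrank_range f g hfg hdg hd1

theorem IsExtFormulation.exists_eq_convexHull {p d : ℕ} {P : Set (Fin p → ℝ)}
    (hP : Bornology.IsBounded P) (hconv : Convex ℝ P) (hne : P.Nonempty)
    (hd : Module.finrank ℝ (vectorSpan ℝ P) = d) (hd1 : 1 ≤ d)
    (h : IsExtFormulation P (d + 1)) :
    ∃ v : Fin (d + 1) → (Fin p → ℝ), P = convexHull ℝ (Set.range v) := by
  obtain ⟨q, K, f, g, x₀, z₀, hfg, hdg, hx₀, hmem⟩ := h.exists_slack hP hne hd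
  obtain ⟨a, ha, hrange⟩ := exists_pos_normal_of_range f g hfg hdg hd1
  have hk := ker_le_ker_of_nonneg f g hfg
  have hfa : ∀ w, a ⬝ᵥ f w = 0 := fun w => (hrange _).1 ⟨w, rfl⟩
  have hker : ∀ x : Fin (d + 1) → ℝ, 0 ≤ x → a ⬝ᵥ x = 0 → x = 0 := by
    intro x hx h0
    have := (Finset.sum_eq_zero_iff_of_nonneg
      (fun i _ => mul_nonneg (ha i).le (hx i))).1 h0
    ext i
    exact (mul_eq_zero.1 (this i (Finset.mem_univ i))).resolve_left (ha i).ne'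
  set β := a ⬝ᵥ x₀ with hβ
  have hβ0 : 0 < β := by
    refine lt_of_le_of_ne (Finset.sum_nonneg fun i _ => mul_nonneg (ha i).le (hx₀ i)) ?_
    intro h0
    have hsub : P ⊆ {z₀} := by
      intro z hz
      obtain ⟨w, hw, rfl⟩ := (hmem z).1 hz
      have hx := hker x₀ hx₀ h0.symm
      rw [hx, zero_add] at hw
      simp [hfg w hw]
    have := vectorSpan_mono ℝ hsub
    rw [vectorSpan_singleton, le_bot_iff] at this
    rw [this, finrank_bot] at hd
    omega
  have hw : ∀ i, ∃ w, f w = Pi.single i (β / a i) - x₀ := fun i => by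
    refine (hrange _).2 ?_
    rw [dotProduct_sub, dotProduct_single, mul_div_cancel₀ _ (ha i).ne', sub_self]
  choose w hw using hw
  refine ⟨fun i => z₀ + g (w i), subset_antisymm ?_ ?_⟩
  · intro z hz
    obtain ⟨u, hu, rfl⟩ := (hmem z).1 hz
    set x := x₀ + f u with hx
    have hax : a ⬝ᵥ x = β := by rw [hx, dotProduct_add, hfa, add_zero]
    set l : Fin (d + 1) → ℝ := fun i => a i * x i / β with hl
    have hl0 : ∀ i, 0 ≤ l i := fun i => div_nonneg (mul_nonneg (ha i).le (hu i)) hβ0.le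
    have hl1 : ∑ i, l i = 1 := by
      rw [hl, ← Finset.sum_div]
      exact (div_eq_one_iff_eq hβ0.ne').2 hax
    have hgu : g u = ∑ i, l i • g (w i) := by
      have : u - ∑ i, l i • w i ∈ LinearMap.ker f := by
        rw [LinearMap.mem_ker, map_sub, map_sum, sub_eq_zero]
        simp only [map_smul, hw, smul_sub, Finset.sum_sub_distrib, ← Finset.sum_smul, hl1,
          one_smul]
        rw [eq_sub_iff_add_eq, add_comm (f u), ← hx]
        conv_lhs => rw [pi_eq_sum_univ' x]
        refine Finset.sum_congr rfl fun i _ => ?_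
        rw [← Pi.single_smul', ← Pi.single_smul', hl]
        congr 1
        have := (ha i).ne'
        simp only [smul_eq_mul]
        field_simp
      have := hk this
      rw [LinearMap.mem_ker, map_sub, map_sum, sub_eq_zero] at this
      simpa using this
    have hz : z₀ + g u = ∑ i, l i • (z₀ + g (w i)) := by
      simp only [smul_add, Finset.sum_add_distrib, ← Finset.sum_smul, hl1, one_smul, hgu]
    rw [hz]
    exact (convex_convexHull ℝ _).sum_mem (fun i _ => hl0 i) hl1
      fun i _ => subset_convexHull ℝ _ ⟨i, rfl⟩
  · refine convexHull_min ?_ hconv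
    rintro _ ⟨i, rfl⟩
    refine (hmem _).2 ⟨w i, ?_, rfl⟩
    rw [hw, add_sub_cancel]
    exact Pi.single_nonneg.2 (div_pos hβ0 (ha i)).le

theorem isExtFormulation_convexHull_range {p m : ℕ} (v : Fin m → (Fin p → ℝ)) :
    IsExtFormulation (convexHull ℝ (Set.range v)) m := by
  refine ⟨m, 1, -1, 0, Matrix.of fun _ _ => 1, 1, Fintype.linearCombination ℝ v, ?_⟩
  have hs : {y : Fin m → ℝ | (-1 : Matrix (Fin m) (Fin m) ℝ).mulVec y ≤ 0 ∧
      (Matrix.of fun _ _ => 1 : Matrix (Fin 1) (Fin m) ℝ).mulVec y = 1} = stdSimplex ℝ (Fin m) := by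
    ext y
    simp [stdSimplex, Matrix.neg_mulVec, Pi.le_def, funext_iff, Matrix.mulVec, dotProduct]
  rw [hs, ← convexHull_basis_eq_stdSimplex, LinearMap.image_convexHull, ← Set.range_comp]
  congr 2
  ext i : 1
  simp [Fintype.linearCombination_apply]

/-- A polytope whose affine hull has dimension `d ≥ 1`
satisfies `xc(P) = d + 1` iff `P` is a `d`-simplex, i.e. the convex hull of
`d + 1` affinely independent points. -/
theorem stmt10 {p d : ℕ} (P : Set (Fin p → ℝ)) (hpoly : IsPolytope P)
    (hd : Module.finrank ℝ (affineSpan ℝ P).direction = d) (hd1 : 1 ≤ d) :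
    xc P = d + 1 ↔
      ∃ s : Finset (Fin p → ℝ), s.card = d + 1 ∧
        AffineIndependent ℝ (fun x : ↥s => (x : Fin p → ℝ)) ∧
        P = convexHull ℝ (s : Set (Fin p → ℝ)) := by
  rw [direction_affineSpan] at hd
  obtain ⟨hbdd, hconv⟩ : Bornology.IsBounded P ∧ Convex ℝ P := by
    obtain ⟨V, rfl⟩ := hpoly
    exact ⟨isBounded_convexHull.2 V.finite_toSet.isBounded, convex_convexHull ℝ _⟩
  have hne : P.Nonempty := by
    rw [Set.nonempty_iff_ne_empty]
    rintro rfl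
    rw [vectorSpan_empty, finrank_bot] at hd
    omega
  constructor
  · intro hx
    have hmem : IsExtFormulation P (d + 1) := by
      rw [← hx]
      exact Nat.sInf_mem (Nat.nonempty_of_pos_sInf (by change 0 < xc P; omega))
    obtain ⟨v, rfl⟩ := hmem.exists_eq_convexHull hbdd hconv hne hd hd1
    rw [← direction_affineSpan, affineSpan_convexHull, direction_affineSpan] at hd
    have hv : AffineIndependent ℝ v :=
      (affineIndependent_iff_finrank_vectorSpan_eq ℝ v (Fintype.card_fin _)).2 hd
    classical
    refine ⟨Finset.univ.image v, ?_, ?_, by simp⟩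
    · rw [Finset.card_image_of_injective _ hv.injective, Finset.card_univ, Fintype.card_fin]
    · have hset : ((Finset.univ.image v : Finset _) : Set (Fin p → ℝ)) = Set.range v := by simp
      exact hv.range.mono hset.le
  · rintro ⟨s, hs, -, rfl⟩
    have hform : IsExtFormulation (convexHull ℝ (s : Set (Fin p → ℝ))) (d + 1) := by
      have := isExtFormulation_convexHull_range
        (fun i : Fin (d + 1) => ((s.equivFinOfCardEq hs).symm i : Fin p → ℝ))
      convert this
      ext x
      constructor
      · exact fun hx => ⟨s.equivFinOfCardEq hs ⟨x, hx⟩, by simp⟩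
      · rintro ⟨i, rfl⟩
        exact Subtype.property _
    refine le_antisymm (Nat.sInf_le hform) ?_
    have hmem : IsExtFormulation _ (xc (convexHull ℝ (s : Set (Fin p → ℝ)))) :=
      Nat.sInf_mem (s := {m | IsExtFormulation (convexHull ℝ (s : Set (Fin p → ℝ))) m})
        ⟨_, hform⟩
    exact hmem.lt hbdd hne hd hd1
end
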